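/- For every real λ > 1 there exist a constant C_λ > 0 and, with N = 32⌈λ⌉, the following property: for every small polymer X (a connected polymer with at most 4 blocks) there exist vectors v₁ = 0, v₂, …, v_N ∈ ℤ² with |v_i| ≤ C_λ such that the interiors of the translates X + v₁, …, X + v_N are pairwise disjoint, and for every function f of class C¹ on a neighborhood of K := { x ∈ ℝ² : dist(x, X) ≤ C_λ }: λ·∫_X |f|² ≤ Σ_{i=1}^{N} ∫_{X+v_i} |f|² + C_λ · sup_K |∇f|². -/

import Mathlib

open MeasureTheory

noncomputable section

/-- The plane, with its Euclidean structure. -/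
abbrev E2 := EuclideanSpace ℝ (Fin 2)

/-- The closed unit square (block) of the standard tessellation of `ℝ²` with lower-left
corner `p ∈ ℤ²`. -/
def unitSquare (p : ℤ × ℤ) : Set E2 :=
  {x | (p.1 : ℝ) ≤ x 0 ∧ x 0 ≤ (p.1 : ℝ) + 1 ∧ (p.2 : ℝ) ≤ x 1 ∧ x 1 ≤ (p.2 : ℝ) + 1}

/-- The polymer (finite union of closed unit squares) indexed by a finite set `S ⊆ ℤ²`. -/
def polymerOf (S : Finset (ℤ × ℤ)) : Set E2 := ⋃ p ∈ S, unitSquare p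

/-- The point of `ℝ²` with integer coordinates `w ∈ ℤ²`. -/
def intVec (w : ℤ × ℤ) : E2 := (WithLp.equiv 2 (Fin 2 → ℝ)).symm ![(w.1 : ℝ), (w.2 : ℝ)]

lemma intVec_zero' (w : ℤ × ℤ) : intVec w 0 = (w.1 : ℝ) := by simp [intVec]

lemma intVec_one' (w : ℤ × ℤ) : intVec w 1 = (w.2 : ℝ) := by simp [intVec]

lemma unitSquare_compact (p : ℤ × ℤ) : IsCompact (unitSquare p) := by
  have h : unitSquare p = (EuclideanSpace.equiv (Fin 2) ℝ).toHomeomorph ⁻¹'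
      (Set.Icc ![(p.1 : ℝ), (p.2 : ℝ)] ![(p.1 : ℝ) + 1, (p.2 : ℝ) + 1]) := by
    ext x
    simp [unitSquare, Pi.le_def, Fin.forall_fin_two]
    tauto
  rw [h]
  exact (Homeomorph.isCompact_preimage _).2 isCompact_Icc

lemma polymer_compact (S : Finset (ℤ × ℤ)) : IsCompact (polymerOf S) :=
  S.isCompact_biUnion fun p _ => unitSquare_compact p

lemma unitSquare_volume (p : ℤ × ℤ) :
    volume.real (unitSquare p) = volume.real (unitSquare 0) := by
  have h : unitSquare 0 = (fun x => x + intVec p) ⁻¹' unitSquare p := by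
    ext x
    simp [unitSquare, intVec_zero', intVec_one']
    intros
    constructor <;> intro h <;> (try constructor) <;> (try constructor) <;> linarith [h.1, h.2]
  unfold Measure.real
  rw [h, measure_preimage_add_right]

lemma polymer_volume (S : Finset (ℤ × ℤ)) (hS : S.card ≤ 4) :
    volume.real (polymerOf S) ≤ 4 * volume.real (unitSquare 0) := by
  have h1 : volume.real (polymerOf S) ≤ ∑ p ∈ S, volume.real (unitSquare p) :=
    measureReal_biUnion_finset_le S unitSquare
  simp only [unitSquare_volume, Finset.sum_const, nsmul_eq_mul] at h1
  have h2 : (S.card : ℝ) ≤ 4 := by exact_mod_cast hS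
  have h3 : 0 ≤ volume.real (unitSquare 0) := measureReal_nonneg
  nlinarith

lemma exists_step (S : Finset (ℤ × ℤ)) (hS : S.card ≤ 4) (N : ℕ) :
    ∃ k : ℕ, k ≤ 16 * N + 1 ∧
      ∀ d : ℕ, 0 < d → d ≤ N → ∀ p ∈ S, ∀ q ∈ S, p.1 - q.1 ≠ (k : ℤ) * d := by
  classical
  let B : Finset ℕ := ((S ×ˢ S) ×ˢ Finset.Icc 1 N).image
    fun t => ((t.1.1.1 - t.1.2.1) / (t.2 : ℤ)).toNat
  have hB : B.card < (Finset.Icc 1 (16 * N + 1)).card := by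
    have h1 : B.card ≤ ((S ×ˢ S) ×ˢ Finset.Icc 1 N).card := Finset.card_image_le
    simp only [Finset.card_product, Nat.card_Icc] at h1 ⊢
    have : S.card * S.card ≤ 16 := by nlinarith
    have := Nat.mul_le_mul_right (N + 1 - 1) this
    omega
  obtain ⟨k, hk, hkB⟩ := Finset.exists_mem_notMem_of_card_lt_card hB
  refine ⟨k, (Finset.mem_Icc.1 hk).2, fun d hd hdN p hp q hq h => hkB ?_⟩
  refine Finset.mem_image.2 ⟨((p, q), d), ?_, ?_⟩
  · simp [hp, hq]; omega
  · simp only [h]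
    rw [Int.mul_ediv_cancel _ (by positivity)]
    simp

lemma dense_irr : Dense {x : E2 | Irrational (x 0) ∧ Irrational (x 1)} := by
  have h : Dense (Set.pi (Set.univ : Set (Fin 2)) fun _ => {x : ℝ | Irrational x}) :=
    dense_pi _ fun _ _ => dense_irrational
  have h2 := h.preimage (EuclideanSpace.equiv (Fin 2) ℝ).toHomeomorph.isOpenMap
  convert h2 using 1
  ext x
  simp [Set.mem_pi, Fin.forall_fin_two]

lemma floor_unique {y : ℝ} (hy : Irrational y) {a : ℤ} (h1 : (a : ℝ) ≤ y) (h2 : y ≤ a + 1) :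
    a = ⌊y⌋ := by
  symm
  rw [Int.floor_eq_iff]
  refine ⟨h1, lt_of_le_of_ne h2 ?_⟩
  have := hy.ne_int (a + 1)
  push_cast at this
  exact this

lemma mem_image_polymer {S : Finset (ℤ × ℤ)} {w : ℤ × ℤ} {x : E2}
    (h0 : Irrational (x 0)) (h1 : Irrational (x 1))
    (h : x ∈ (fun x => x + intVec w) '' polymerOf S) :
    ∃ p ∈ S, p.1 + w.1 = ⌊x 0⌋ ∧ p.2 + w.2 = ⌊x 1⌋ := by
  obtain ⟨y, hy, rfl⟩ := h
  simp only [polymerOf, Set.mem_iUnion] at hy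
  obtain ⟨p, hp, a, b, c, d⟩ := hy
  refine ⟨p, hp, floor_unique h0 ?_ ?_, floor_unique h1 ?_ ?_⟩ <;>
    simp [intVec_zero', intVec_one'] <;> linarith

lemma disjoint_translates {S : Finset (ℤ × ℤ)} {w w' : ℤ × ℤ}
    (h : ∀ p ∈ S, ∀ q ∈ S, p.1 - q.1 ≠ w'.1 - w.1) :
    Disjoint (interior ((fun x => x + intVec w) '' polymerOf S))
      (interior ((fun x => x + intVec w') '' polymerOf S)) := by
  rw [Set.disjoint_iff_inter_eq_empty]
  by_contra hne
  obtain ⟨x, hx, hx0, hx1⟩ := dense_irr.inter_open_nonempty _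
    (isOpen_interior.inter isOpen_interior) (Set.nonempty_iff_ne_empty.2 hne)
  obtain ⟨p, hp, e1, -⟩ := mem_image_polymer hx0 hx1 (interior_subset hx.1)
  obtain ⟨q, hq, e2, -⟩ := mem_image_polymer hx0 hx1 (interior_subset hx.2)
  exact h p hp q hq (by omega)

lemma one_translate {X U : Set E2} {f : E2 → ℝ} {C R M : ℝ} {w : E2} (hX : IsCompact X)
    (hRC : R ≤ C) (hU : IsOpen U) (hKU : Metric.cthickening C X ⊆ U)
    (hf : ContDiffOn ℝ 1 f U) (hw : ‖w‖ ≤ R)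
    (hM : ∀ x ∈ Metric.cthickening C X, ‖fderiv ℝ f x‖ ^ 2 ≤ M) :
    ∫ x in X, f x ^ 2 ≤ 2 * (∫ x in (fun y => y + w) '' X, f x ^ 2) +
      2 * volume.real X * (R ^ 2 * M) := by
  have hball : ∀ x ∈ X, Metric.closedBall x C ⊆ Metric.cthickening C X := fun x hx =>
    Metric.closedBall_subset_cthickening hx C
  have hR : 0 ≤ R := (norm_nonneg _).trans hw
  have hxU : ∀ x ∈ X, x ∈ U := fun x hx => hKU (hball x hx (Metric.mem_closedBall_self (hR.trans hRC)))
  have hmem : ∀ x ∈ X, x + w ∈ Metric.closedBall x C := fun x hx => by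
    simp; linarith
  have hxwU : ∀ x ∈ X, x + w ∈ U := fun x hx => hKU (hball x hx (hmem x hx))
  have key : ∀ x ∈ X, f x ^ 2 ≤ 2 * f (x + w) ^ 2 + 2 * (R ^ 2 * M) := by
    intro x hx
    have hC : x ∈ Metric.closedBall x C := Metric.mem_closedBall_self (hR.trans hRC)
    have hM0 : 0 ≤ M := (sq_nonneg _).trans (hM x (hball x hx hC))
    have h := (convex_closedBall x C).norm_image_sub_le_of_norm_fderiv_le (𝕜 := ℝ) (f := f)
      (C := √M) (x := x) (y := x + w)
      (fun z hz => ((hf.differentiableOn (by norm_num)) z (hKU (hball x hx hz))).differentiableAt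
        (hU.mem_nhds (hKU (hball x hx hz))))
      (fun z hz => Real.le_sqrt_of_sq_le (hM z (hball x hx hz))) hC (hmem x hx)
    rw [add_sub_cancel_left, Real.norm_eq_abs] at h
    have h2 : |f (x + w) - f x| ≤ √M * R :=
      h.trans (mul_le_mul_of_nonneg_left hw (Real.sqrt_nonneg _))
    have h3 : (f (x + w) - f x) ^ 2 ≤ R ^ 2 * M := by
      rw [← sq_abs]
      calc |f (x + w) - f x| ^ 2 ≤ (√M * R) ^ 2 := by gcongr
        _ = R ^ 2 * M := by rw [mul_pow, Real.sq_sqrt hM0]; ring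
    nlinarith [sq_nonneg (2 * f (x + w) - f x)]
  have i1 : IntegrableOn (fun x => f x ^ 2) X :=
    ((hf.continuousOn.mono hxU).pow 2).integrableOn_compact hX
  have i2 : IntegrableOn (fun x => f (x + w) ^ 2) X := by
    refine ContinuousOn.integrableOn_compact hX (ContinuousOn.pow ?_ 2)
    exact hf.continuousOn.comp (by fun_prop) hxwU
  have i3 : IntegrableOn (fun _ : E2 => 2 * (R ^ 2 * M)) X :=
    continuousOn_const.integrableOn_compact hX
  have e : ∫ x in (fun y => y + w) '' X, f x ^ 2 = ∫ x in X, f (x + w) ^ 2 :=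
    (measurePreserving_add_right volume w).setIntegral_image_emb
      (measurableEmbedding_addRight w) (fun x => f x ^ 2) X
  have := setIntegral_mono_on i1 ((i2.const_mul 2).add i3) hX.measurableSet key
  simp only [Pi.add_apply] at this
  rw [integral_add (i2.const_mul 2) i3, integral_const_mul, setIntegral_const, smul_eq_mul] at this
  rw [e]
  linarith

/-- For every `λ > 1` there are `C_λ > 0` and, with `N = 32⌈λ⌉`, for every small polymer
`X` there are integer translation vectors `v₁ = 0, v₂, …, v_N` of norm at most `C_λ` whose
translates of `X` have pairwise disjoint interiors, such that for every `f` of class `C¹`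
on a neighborhood of `K = {x : dist(x, X) ≤ C_λ}`:
`λ ∫_X |f|² ≤ Σ_i ∫_{X+vᵢ} |f|² + C_λ sup_K |∇f|²`. -/
theorem stmt8 (lam : ℝ) (hlam : 1 < lam) :
    ∃ C : ℝ, 0 < C ∧
      ∀ S : Finset (ℤ × ℤ), S.Nonempty → S.card ≤ 4 → IsConnected (polymerOf S) →
        ∃ v : ℕ → ℤ × ℤ, v 0 = 0 ∧
          (∀ i < 32 * ⌈lam⌉₊, ‖intVec (v i)‖ ≤ C) ∧
          (∀ i < 32 * ⌈lam⌉₊, ∀ j < 32 * ⌈lam⌉₊, i ≠ j →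
            Disjoint (interior ((fun x => x + intVec (v i)) '' polymerOf S))
                     (interior ((fun x => x + intVec (v j)) '' polymerOf S))) ∧
          ∀ (f : E2 → ℝ) (U : Set E2), IsOpen U →
            Metric.cthickening C (polymerOf S) ⊆ U → ContDiffOn ℝ 1 f U →
            lam * (∫ x in polymerOf S, f x ^ 2) ≤
              (∑ i ∈ Finset.range (32 * ⌈lam⌉₊),
                ∫ x in (fun y => y + intVec (v i)) '' polymerOf S, f x ^ 2) +
              C * ⨆ x ∈ Metric.cthickening C (polymerOf S), ‖fderiv ℝ f x‖ ^ 2 := by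
  obtain ⟨N, hN⟩ : ∃ N, N = 32 * ⌈lam⌉₊ := ⟨_, rfl⟩
  rw [← hN]
  have hNl : lam ≤ (N : ℝ) / 2 := by
    have := Nat.le_ceil lam
    rw [hN]; push_cast; linarith
  let V := volume.real (unitSquare 0)
  have hV : 0 ≤ V := measureReal_nonneg
  let R : ℝ := ((16 * N + 1) * N : ℝ)
  have hR : 0 ≤ R := by positivity
  refine ⟨R + 1 + N * (4 * V) * R ^ 2, by positivity, ?_⟩
  intro S _ hcard _
  obtain ⟨C, hC⟩ : ∃ C, C = R + 1 + N * (4 * V) * R ^ 2 := ⟨_, rfl⟩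
  rw [← hC]
  have hRC : R ≤ C := by rw [hC]; have : 0 ≤ N * (4 * V) * R ^ 2 := by positivity
                         linarith
  have hC2 : N * (4 * V) * R ^ 2 ≤ C := by rw [hC]; linarith
  obtain ⟨k, hk, hkd⟩ := exists_step S hcard N
  have hnorm : ∀ i < N, ‖intVec ((k : ℤ) * i, 0)‖ ≤ R := by
    intro i hi
    have : ‖intVec ((k : ℤ) * i, 0)‖ = (k : ℝ) * i := by
      rw [EuclideanSpace.norm_eq]
      simp [Fin.sum_univ_two, intVec_zero', intVec_one']
      rw [Real.sqrt_sq (by positivity)]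
    rw [this]
    have h1 : (k : ℝ) ≤ 16 * N + 1 := by exact_mod_cast hk
    have h2 : (i : ℝ) ≤ N := by exact_mod_cast hi.le
    exact mul_le_mul h1 h2 (by positivity) (by positivity)
  refine ⟨fun i => ((k : ℤ) * i, 0), by simp, fun i hi => (hnorm i hi).trans hRC, ?_, ?_⟩
  · intro i hi j hj hij
    rcases lt_or_gt_of_ne hij with h | h
    · refine disjoint_translates fun p hp q hq => ?_
      have := hkd (j - i) (by omega) (by omega) p hp q hq
      rw [Nat.cast_sub h.le, mul_sub] at this
      exact this
    · refine (disjoint_translates fun p hp q hq => ?_).symm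
      have := hkd (i - j) (by omega) (by omega) p hp q hq
      rw [Nat.cast_sub h.le, mul_sub] at this
      exact this
  · intro f U hU hKU hf
    have hX := polymer_compact S
    set K := Metric.cthickening C (polymerOf S) with hK
    have hKc : IsCompact K := hX.cthickening
    have hcont : ContinuousOn (fun x => ‖fderiv ℝ f x‖ ^ 2) K :=
      (((hf.continuousOn_fderiv_of_isOpen hU le_rfl).mono hKU).norm).pow 2
    obtain ⟨B, hB⟩ := hKc.bddAbove_image hcont
    set M := ⨆ x ∈ K, ‖fderiv ℝ f x‖ ^ 2 with hMdef
    have hbdd : BddAbove (Set.range fun x => ⨆ (_ : x ∈ K), ‖fderiv ℝ f x‖ ^ 2) := by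
      refine ⟨max B 0, ?_⟩
      rintro _ ⟨x, rfl⟩
      by_cases hx : x ∈ K
      · simp only [hx, ciSup_unique]
        exact le_max_of_le_left (hB ⟨x, hx, rfl⟩)
      · simp [hx]
    have hM : ∀ x ∈ K, ‖fderiv ℝ f x‖ ^ 2 ≤ M := by
      intro x hx
      have := le_ciSup hbdd x
      simpa [hx] using this
    have hM0 : 0 ≤ M := Real.iSup_nonneg fun x => Real.iSup_nonneg fun _ => sq_nonneg _
    have hI : 0 ≤ ∫ x in polymerOf S, f x ^ 2 := integral_nonneg fun x => sq_nonneg _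
    have hs : ∑ i ∈ Finset.range N, (∫ x in polymerOf S, f x ^ 2) ≤
        ∑ i ∈ Finset.range N,
          (2 * (∫ x in (fun y => y + intVec ((k : ℤ) * i, 0)) '' polymerOf S, f x ^ 2) +
            2 * volume.real (polymerOf S) * (R ^ 2 * M)) :=
      Finset.sum_le_sum fun i hi => one_translate hX hRC hU hKU hf
        (hnorm i (Finset.mem_range.1 hi)) hM
    rw [Finset.sum_add_distrib, ← Finset.mul_sum, Finset.sum_const, Finset.sum_const,
      Finset.card_range, nsmul_eq_mul, nsmul_eq_mul] at hs
    have hvol := polymer_volume S hcard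
    have h1 : N * (volume.real (polymerOf S) * (R ^ 2 * M)) ≤ N * (4 * V * (R ^ 2 * M)) := by
      gcongr
    have h2 := mul_le_mul_of_nonneg_right hC2 hM0
    have h3 := mul_le_mul_of_nonneg_right hNl hI
    linarith

end
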